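/- For every constant ε > 0, the number of collaborating agents needed to explore every connected graph on at most n vertices is at least Ω(log log n) when each agent is allowed at most O((log n)^{1−ε}) bits of memory. Concretely: for every ε with 0 < ε < 1 and every constant c ∈ ℕ there is a constant c' > 0 such that for all sufficiently large n, if a set of k collaborating agents with at most 2^{c·(log n)^{1−ε}} states each explores every connected graph on at most n vertices, then k ≥ c'·log log n. -/

import Mathlib

noncomputable section
open scoped Classical

/-- An undirected graph with locally labeled ports: vertex `v` has degree `deg v`,
and for a port `i < deg v`, `nbr v i` is the other endpoint of the edge with port
number `i` at `v`, while `back v i` is the port number of this edge at the other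
endpoint. -/
structure PGraph (V : Type) where
  deg : V → ℕ
  nbr : V → ℕ → V
  back : V → ℕ → ℕ

namespace PGraph

variable {V : Type}

/-- Well-formedness: positive degrees, ports of an edge match up at both
endpoints, no self-loops and no parallel edges. -/
def Wf (G : PGraph V) : Prop :=
  (∀ v, 0 < G.deg v) ∧
  (∀ v i, i < G.deg v → G.back v i < G.deg (G.nbr v i)) ∧
  (∀ v i, i < G.deg v → G.nbr (G.nbr v i) (G.back v i) = v) ∧
  (∀ v i, i < G.deg v → G.back (G.nbr v i) (G.back v i) = i) ∧
  (∀ v i, i < G.deg v → G.nbr v i ≠ v) ∧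
  (∀ v, Set.InjOn (G.nbr v) (Set.Iio (G.deg v)))

/-- Connectivity of a port-labeled graph. -/
def Conn (G : PGraph V) : Prop :=
  ∀ a b : V, Relation.ReflTransGen (fun x y => ∃ i, i < G.deg x ∧ G.nbr x i = y) a b

end PGraph

/-- A system of `k` collaborating agents, agent `i` having `sz i` states.  The
transition function of agent `i` maps (its state, the vector of states of the
agents sharing its current vertex (`none` for agents located elsewhere), the
degree of the current vertex, the port number of the edge it entered through)
to (new state, move (`none` = stay)). -/
structure MAgentSys (k : ℕ) (sz : Fin k → ℕ) where
  start : ∀ i, Fin (sz i)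
  halt : ∀ i, Finset (Fin (sz i))
  trans : ∀ i, Fin (sz i) → (∀ j, Option (Fin (sz j))) → ℕ → ℕ → Fin (sz i) × Option ℕ

/-- A configuration of a system of collaborating agents. -/
structure MConfig (V : Type) (k : ℕ) (sz : Fin k → ℕ) where
  st : ∀ i, Fin (sz i)
  pos : Fin k → V
  lab : Fin k → ℕ

variable {V : Type} {k : ℕ} {sz : Fin k → ℕ}

/-- The states visible to agent `i`: the states of the other agents sharing its
current vertex. -/
def mVis (c : MConfig V k sz) (i : Fin k) : ∀ j, Option (Fin (sz j)) := fun j =>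
  if j = i then none else if c.pos j = c.pos i then some (c.st j) else none

def mOut (A : MAgentSys k sz) (G : PGraph V) (c : MConfig V k sz) (i : Fin k) :
    Fin (sz i) × Option ℕ :=
  A.trans i (c.st i) (mVis c i) (G.deg (c.pos i)) (c.lab i)

/-- One synchronous step of the system; halted agents stay put. -/
def mStep (A : MAgentSys k sz) (G : PGraph V) (c : MConfig V k sz) : MConfig V k sz where
  st := fun i => if c.st i ∈ A.halt i then c.st i else (mOut A G c i).1
  pos := fun i =>
    if c.st i ∈ A.halt i then c.pos i
    else
      (match (mOut A G c i).2 with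
      | none => c.pos i
      | some l => if l < G.deg (c.pos i) then G.nbr (c.pos i) l else c.pos i)
  lab := fun i =>
    if c.st i ∈ A.halt i then c.lab i
    else
      (match (mOut A G c i).2 with
      | none => c.lab i
      | some l => if l < G.deg (c.pos i) then G.back (c.pos i) l else c.lab i)

/-- The run of the system, with all agents starting at `v0`. -/
def mRun (A : MAgentSys k sz) (G : PGraph V) (v0 : V) (t : ℕ) : MConfig V k sz :=
  (mStep A G)^[t] ⟨fun i => A.start i, fun _ => v0, fun _ => 0⟩

/-- Number of edge traversals performed by agent `i` during the first `N` steps. -/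
def mTrav (A : MAgentSys k sz) (G : PGraph V) (v0 : V) (i : Fin k) (N : ℕ) : ℕ :=
  ((Finset.range N).filter
    (fun t => (mRun A G v0 (t + 1)).pos i ≠ (mRun A G v0 t).pos i)).card

/-! ### Translation-invariant systems of interacting agents on a group -/

/-- The states of the agents of `A` located at the position of agent `i`. -/
def visIn {ι : Type} {Q : ι → Type} {Γ : Type} (A : Finset ι) (c : ∀ i, Q i × Γ) (i : ι) :
    ∀ j, Option (Q j) :=
  fun j => if j ∈ A ∧ (c j).2 = (c i).2 then some (c j).1 else none

/-- One step of the agents of `A`, as if no other agents were present; the agents outside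
`A` are frozen. -/
def stepIn {ι : Type} {Q : ι → Type} {Γ : Type} [AddCommGroup Γ]
    (δ : ∀ i, Q i → (∀ j, Option (Q j)) → Q i × Γ) (A : Finset ι) (c : ∀ i, Q i × Γ) :
    ∀ i, Q i × Γ :=
  fun i => if i ∈ A then
    ((δ i (c i).1 (visIn A c i)).1, (c i).2 + (δ i (c i).1 (visIn A c i)).2) else c i

/-- The configurations `c` and `c'` agree on `A` up to translation by `g`. -/
def RelOn {ι : Type} {Q : ι → Type} {Γ : Type} [AddCommGroup Γ]
    (A : Finset ι) (g : Γ) (c c' : ∀ i, Q i × Γ) : Prop :=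
  ∀ i ∈ A, c' i = ((c i).1, (c i).2 + g)

/-- The set `A` of agents can be assembled from single agents by repeatedly uniting two
disjoint sets which, each of them run on its own, meet at some time. -/
inductive Linked {ι : Type} {Q : ι → Type} {Γ : Type} [AddCommGroup Γ]
    (δ : ∀ i, Q i → (∀ j, Option (Q j)) → Q i × Γ) (c : ∀ i, Q i × Γ) : Finset ι → Prop
  | single (i : ι) : Linked δ c {i}
  | merge (A B : Finset ι) (t : ℕ) (i j : ι) (hA : Linked δ c A) (hB : Linked δ c B)
      (hAB : Disjoint A B) (hi : i ∈ A) (hj : j ∈ B)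
      (h : (((stepIn δ A)^[t] c) i).2 = (((stepIn δ B)^[t] c) j).2) : Linked δ c (A ∪ B)

section Abstract

variable {ι : Type} {Q : ι → Type} {Γ : Type} [AddCommGroup Γ]
  {δ : ∀ i, Q i → (∀ j, Option (Q j)) → Q i × Γ}

lemma RelOn.step {A : Finset ι} {g : Γ} {c c' : ∀ i, Q i × Γ} (h : RelOn A g c c') :
    RelOn A g (stepIn δ A c) (stepIn δ A c') := by
  intro i hi
  have hv : visIn A c' i = visIn A c i := by
    funext j
    by_cases hj : j ∈ A
    · simp [visIn, hj, h i hi, h j hj]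
    · simp [visIn, hj]
  simp only [stepIn, hi, if_true, hv]
  rw [h i hi]
  simp only [Prod.mk.injEq, true_and]
  abel

lemma RelOn.iterate {A : Finset ι} {g : Γ} {c c' : ∀ i, Q i × Γ} (h : RelOn A g c c') (t : ℕ) :
    RelOn A g ((stepIn δ A)^[t] c) ((stepIn δ A)^[t] c') := by
  induction t with
  | zero => exact h
  | succ t ih =>
    rw [Function.iterate_succ_apply', Function.iterate_succ_apply']
    exact ih.step

lemma stepIn_iterate_of_notMem {A : Finset ι} {i : ι} (hi : i ∉ A) (c : ∀ i, Q i × Γ) (t : ℕ) :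
    ((stepIn δ A)^[t] c) i = c i := by
  induction t with
  | zero => rfl
  | succ t ih =>
    rw [Function.iterate_succ_apply']
    simp [stepIn, hi, ih]

lemma Linked.nonempty {c : ∀ i, Q i × Γ} {A : Finset ι} (h : Linked δ c A) : A.Nonempty := by
  induction h with
  | single i => exact ⟨i, by simp⟩
  | merge A B t i j hA hB hAB hi hj h => exact ⟨i, by simp [hi]⟩

/-- If agents with different labels never meet when the label classes are run separately,
then the joint run is the union of the separate runs. -/
lemma stepIn_iterate_eq_of_forall_ne {S : Finset ι} {π : ι → ι} {c : ∀ i, Q i × Γ}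
    (h : ∀ i ∈ S, ∀ j ∈ S, π i ≠ π j → ∀ t,
      (((stepIn δ (S.filter (fun x => π x = π i)))^[t] c) i).2 ≠
        (((stepIn δ (S.filter (fun x => π x = π j)))^[t] c) j).2) (t : ℕ) :
    ∀ i ∈ S, ((stepIn δ S)^[t] c) i = ((stepIn δ (S.filter (fun x => π x = π i)))^[t] c) i := by
  induction t with
  | zero => intro i _; rfl
  | succ t ih =>
    intro i hi
    rw [Function.iterate_succ_apply', Function.iterate_succ_apply']
    have hi' : i ∈ S.filter (fun x => π x = π i) := by simp [hi]
    have hv : visIn S ((stepIn δ S)^[t] c) i =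
        visIn (S.filter (fun x => π x = π i))
          ((stepIn δ (S.filter (fun x => π x = π i)))^[t] c) i := by
      funext j
      by_cases hj : j ∈ S
      · by_cases hij : π j = π i
        · have := ih j hj
          rw [hij] at this
          simp [visIn, hj, hij, this, ih i hi]
        · have := h j hj i hi hij t
          simp [visIn, hj, hij, ih j hj, ih i hi, this]
      · simp [visIn, hj]
    simp only [stepIn, hi, hi', if_true, hv, ih i hi]

/-- A set of agents that is not linked splits into two parts that run independently. -/
lemma exists_split_of_not_linked {c : ∀ i, Q i × Γ} {A : Finset ι} (hne : A.Nonempty)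
    (hA : ¬ Linked δ c A) :
    ∃ B ⊆ A, B.Nonempty ∧ (A \ B).Nonempty ∧
      ∀ t, (∀ i ∈ B, ((stepIn δ A)^[t] c) i = ((stepIn δ B)^[t] c) i) ∧
        (∀ i ∈ A \ B, ((stepIn δ A)^[t] c) i = ((stepIn δ (A \ B))^[t] c) i) := by
  have hex : ∃ m : ℕ, ∃ π : ι → ι, (∀ i ∈ A, Linked δ c (A.filter (fun x => π x = π i))) ∧
      (A.image π).card = m := by
    refine ⟨_, id, ?_, rfl⟩
    intro i hi
    have : A.filter (fun x => id x = id i) = {i} := by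
      ext x
      simp only [Finset.mem_filter, Finset.mem_singleton, id]
      exact ⟨fun h => h.2, fun h => ⟨h ▸ hi, h⟩⟩
    rw [this]
    exact Linked.single i
  obtain ⟨π, hπ, hm⟩ := Nat.find_spec hex
  have hmin : ∀ π' : ι → ι, (∀ i ∈ A, Linked δ c (A.filter (fun x => π' x = π' i))) →
      (A.image π).card ≤ (A.image π').card := by
    intro π' h'
    rw [hm]
    exact Nat.find_min' hex ⟨π', h', rfl⟩
  have hsep : ∀ i ∈ A, ∀ j ∈ A, π i ≠ π j → ∀ t,
      (((stepIn δ (A.filter (fun x => π x = π i)))^[t] c) i).2 ≠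
        (((stepIn δ (A.filter (fun x => π x = π j)))^[t] c) j).2 := by
    intro i hi j hj hij t heq
    let π' : ι → ι := fun x => if π x = π j then π i else π x
    have hlink : Linked δ c
        (A.filter (fun x => π x = π i) ∪ A.filter (fun x => π x = π j)) := by
      refine Linked.merge _ _ t i j (hπ i hi) (hπ j hj) ?_ (by simp [hi]) (by simp [hj]) heq
      rw [Finset.disjoint_filter]
      intro x _ h1 h2
      exact hij (h1.symm.trans h2)
    have hle := hmin π' (by
      intro x hx
      by_cases h : π x = π i ∨ π x = π j
      · have : A.filter (fun y => π' y = π' x) =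
            A.filter (fun x => π x = π i) ∪ A.filter (fun x => π x = π j) := by
          ext y
          simp only [Finset.mem_filter, Finset.mem_union, π']
          have hx' : (if π x = π j then π i else π x) = π i := by
            rcases h with h | h <;> simp [h]
          rw [hx']
          by_cases hy : π y = π j
          · simp only [hy, if_true]
            tauto
          · simp [hy]
        rw [this]
        exact hlink
      · push Not at h
        have : A.filter (fun y => π' y = π' x) = A.filter (fun y => π y = π x) := by
          ext y
          simp only [Finset.mem_filter, π', h.2, if_false]
          by_cases hy : π y = π j
          · simp [hy, h.1.symm, h.2.symm]
          · simp [hy]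
        rw [this]
        exact hπ x hx)
    have hsub : A.image π' ⊆ (A.image π).erase (π j) := by
      intro y hy
      obtain ⟨x, hx, rfl⟩ := Finset.mem_image.1 hy
      rw [Finset.mem_erase]
      by_cases h : π x = π j
      · simp only [π', h, if_true]
        exact ⟨hij, Finset.mem_image_of_mem _ hi⟩
      · simp only [π', h, if_false]
        exact ⟨h, Finset.mem_image_of_mem _ hx⟩
    have h1 := Finset.card_le_card hsub
    have h2 := Finset.card_erase_lt_of_mem (Finset.mem_image_of_mem π hj)
    omega
  obtain ⟨a, ha⟩ := hne
  refine ⟨A.filter (fun x => π x = π a), Finset.filter_subset _ _, ⟨a, by simp [ha]⟩, ?_, ?_⟩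
  · rw [Finset.nonempty_iff_ne_empty]
    intro h
    rw [Finset.sdiff_eq_empty_iff_subset] at h
    exact hA ((Finset.Subset.antisymm (Finset.filter_subset _ _) h) ▸ hπ a ha)
  · intro t
    have hall := stepIn_iterate_eq_of_forall_ne hsep t
    constructor
    · intro i hi
      rw [Finset.mem_filter] at hi
      rw [hall i hi.1, hi.2]
    · set B := A \ A.filter (fun x => π x = π a) with hB
      have hcls : ∀ i ∈ B, B.filter (fun x => π x = π i) = A.filter (fun x => π x = π i) := by
        intro i hi
        ext x
        simp only [hB, Finset.mem_sdiff, Finset.mem_filter, not_and] at hi ⊢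
        constructor
        · rintro ⟨⟨h1, _⟩, h2⟩
          exact ⟨h1, h2⟩
        · rintro ⟨h1, h2⟩
          exact ⟨⟨h1, fun _ => h2 ▸ hi.2 hi.1⟩, h2⟩
      have hBA : ∀ i ∈ B, i ∈ A := fun i hi => (Finset.mem_sdiff.1 hi).1
      have hsepB := stepIn_iterate_eq_of_forall_ne (δ := δ) (S := B) (π := π) (c := c) (by
        intro i hi j hj hij s
        rw [hcls i hi, hcls j hj]
        exact hsep i (hBA i hi) j (hBA j hj) hij s) t
      intro i hi
      rw [hall i (hBA i hi), hsepB i hi, hcls i hi]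

end Abstract

/-! ### Orbits of iterated maps -/

lemma exists_lt_iterate_eq_of_iterate_eq {α : Type*} {f : α → α} {x : α} {a b : ℕ} (hab : a < b)
    (h : f^[a] x = f^[b] x) (t : ℕ) : ∃ s < b, f^[s] x = f^[t] x := by
  induction t using Nat.strong_induction_on with
  | _ t ih =>
    by_cases ht : t < b
    · exact ⟨t, ht, rfl⟩
    · obtain ⟨s, hs, he⟩ := ih (t - b + a) (by omega)
      refine ⟨s, hs, he.trans ?_⟩
      have h1 : f^[t] x = f^[t - b] (f^[b] x) := by
        rw [← Function.iterate_add_apply]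
        congr 2
        omega
      rw [h1, ← h, ← Function.iterate_add_apply]

lemma exists_lt_iterate_eq_of_card_le {α : Type*} {f : α → α} {x : α} {F : Finset α} {T : ℕ}
    (hF : F.card ≤ T) (h : ∀ t, f^[t] x ∈ F) (t : ℕ) : ∃ s < T, f^[s] x = f^[t] x := by
  obtain ⟨a, ha, b, hb, hab, he⟩ := Finset.exists_ne_map_eq_of_card_lt_of_maps_to
    (s := Finset.range (T + 1)) (t := F) (f := fun t => f^[t] x)
    (by rw [Finset.card_range]; omega) (fun t _ => h t)
  simp only [Finset.mem_range] at ha hb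
  rcases lt_or_gt_of_ne hab with hlt | hlt
  · obtain ⟨s, hs, hs'⟩ := exists_lt_iterate_eq_of_iterate_eq hlt he t
    exact ⟨s, by omega, hs'⟩
  · obtain ⟨s, hs, hs'⟩ := exists_lt_iterate_eq_of_iterate_eq hlt he.symm t
    exact ⟨s, by omega, hs'⟩

section Counting

variable {ι : Type} {Q : ι → Type} {Γ : Type} [AddCommGroup Γ]
  {δ : ∀ i, Q i → (∀ j, Option (Q j)) → Q i × Γ}

/-- Every configuration in which `A` is linked agrees on `A`, up to translation, with one of
at most `N` configurations. -/
def FewLinked (δ : ∀ i, Q i → (∀ j, Option (Q j)) → Q i × Γ) (A : Finset ι) (N : ℕ) : Prop :=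
  ∃ R : Finset (∀ i, Q i × Γ), R.card ≤ N ∧
    ∀ c, Linked δ c A → ∃ r ∈ R, ∃ g, RelOn A g r c

/-- Every run of `A` on its own passes through at most `T` configurations. -/
def FewVisited (δ : ∀ i, Q i → (∀ j, Option (Q j)) → Q i × Γ) (A : Finset ι) (T : ℕ) : Prop :=
  ∀ c, ∃ F : Finset (∀ i, Q i × Γ), F.card ≤ T ∧ ∀ t, (stepIn δ A)^[t] c ∈ F

lemma FewLinked.mono {A : Finset ι} {N N' : ℕ} (h : FewLinked δ A N) (hN : N ≤ N') :
    FewLinked δ A N' := by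
  obtain ⟨R, hR, h⟩ := h
  exact ⟨R, hR.trans hN, h⟩

lemma FewVisited.mono {A : Finset ι} {N N' : ℕ} (h : FewVisited δ A N) (hN : N ≤ N') :
    FewVisited δ A N' := by
  intro c
  obtain ⟨R, hR, h⟩ := h c
  exact ⟨R, hR.trans hN, h⟩

lemma exists_meeting_time_lt {A B : Finset ι} {TA TB : ℕ} (hA : FewVisited δ A TA)
    (hB : FewVisited δ B TB) (c : ∀ i, Q i × Γ) (t : ℕ) :
    ∃ s < TA * TB, (stepIn δ A)^[s] c = (stepIn δ A)^[t] c ∧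
      (stepIn δ B)^[s] c = (stepIn δ B)^[t] c := by
  obtain ⟨FA, hFA, hA⟩ := hA c
  obtain ⟨FB, hFB, hB⟩ := hB c
  have hp : ∀ t, (Prod.map (stepIn δ A) (stepIn δ B))^[t] (c, c) =
      ((stepIn δ A)^[t] c, (stepIn δ B)^[t] c) := by
    intro t
    rw [Prod.map_iterate]
    rfl
  obtain ⟨s, hs, he⟩ := exists_lt_iterate_eq_of_card_le
    (f := Prod.map (stepIn δ A) (stepIn δ B)) (x := (c, c)) (F := FA ×ˢ FB) (T := TA * TB)
    (by rw [Finset.card_product]; exact Nat.mul_le_mul hFA hFB)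
    (fun t => by rw [hp, Finset.mem_product]; exact ⟨hA t, hB t⟩) t
  rw [hp, hp, Prod.mk.injEq] at he
  exact ⟨s, hs, he⟩

lemma fewLinked_singleton (i : ι) [Finite (Q i)] {M : ℕ} (hM : Nat.card (Q i) ≤ M) : FewLinked δ {i} M := by
  by_cases hne : Nonempty (∀ i, Q i)
  · obtain ⟨q⟩ := hne
    have := Fintype.ofFinite (Q i)
    refine ⟨Finset.univ.image (fun a : Q i => fun j => ((Function.update q i a) j, (0 : Γ))), ?_, ?_⟩
    · refine Finset.card_image_le.trans ?_
      rwa [Finset.card_univ, ← Nat.card_eq_fintype_card]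
    · intro c _
      refine ⟨_, Finset.mem_image_of_mem _ (Finset.mem_univ (c i).1), (c i).2, ?_⟩
      intro j hj
      obtain rfl := Finset.mem_singleton.1 hj
      simp
  · refine ⟨∅, by simp, fun c _ => ?_⟩
    exact (hne ⟨fun i => (c i).1⟩).elim

lemma fewLinked_of_parts {A : Finset ι} (hA : 2 ≤ A.card) {N T : ℕ}
    (hN : ∀ B ⊆ A, B.Nonempty → (A \ B).Nonempty →
      ∃ N₁ N₂ T₁ T₂, FewLinked δ B N₁ ∧ FewLinked δ (A \ B) N₂ ∧
        FewVisited δ B T₁ ∧ FewVisited δ (A \ B) T₂ ∧ N₁ * N₂ ≤ N ∧ T₁ * T₂ ≤ T) :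
    FewLinked δ A (2 ^ A.card * (N * A.card ^ 2 * T)) := by
  have key : ∀ B ⊆ A, B.Nonempty → (A \ B).Nonempty →
      ∃ R : Finset (∀ i, Q i × Γ), R.card ≤ N * A.card ^ 2 * T ∧
        ∀ c, Linked δ c B → Linked δ c (A \ B) → ∀ i ∈ B, ∀ j ∈ A \ B, ∀ t,
          (((stepIn δ B)^[t] c) i).2 = (((stepIn δ (A \ B))^[t] c) j).2 →
          ∃ r ∈ R, ∃ g, RelOn A g r c := by
    intro B hB hB1 hB2
    obtain ⟨N₁, N₂, T₁, T₂, ⟨R₁, hR₁, h₁⟩, ⟨R₂, hR₂, h₂⟩, hT₁, hT₂, hNN, hTT⟩ := hN B hB hB1 hB2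
    let rep : ((∀ i, Q i × Γ) × (∀ i, Q i × Γ)) × (ι × ι) × ℕ → (∀ i, Q i × Γ) :=
      fun p x => if x ∈ B then p.1.1 x else
        ((p.1.2 x).1, (p.1.2 x).2 + ((((stepIn δ B)^[p.2.2] p.1.1) p.2.1.1).2 -
          (((stepIn δ (A \ B))^[p.2.2] p.1.2) p.2.1.2).2))
    refine ⟨((R₁ ×ˢ R₂) ×ˢ (A ×ˢ A) ×ˢ Finset.range (T₁ * T₂)).image rep, ?_, ?_⟩
    · refine Finset.card_image_le.trans ?_
      simp only [Finset.card_product, Finset.card_range]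
      calc R₁.card * R₂.card * (A.card * A.card * (T₁ * T₂))
          ≤ (N₁ * N₂) * (A.card * A.card * (T₁ * T₂)) := by gcongr
        _ ≤ N * (A.card * A.card * T) := by gcongr
        _ = N * A.card ^ 2 * T := by ring
    · intro c hcB hcA i hi j hj t heq
      obtain ⟨s, hs, hs1, hs2⟩ := exists_meeting_time_lt hT₁ hT₂ c t
      rw [← hs1, ← hs2] at heq
      obtain ⟨r₁, hr₁, g, hg⟩ := h₁ c hcB
      obtain ⟨r₂, hr₂, g', hg'⟩ := h₂ c hcA
      have e1 := hg.iterate (δ := δ) s i hi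
      have e2 := hg'.iterate (δ := δ) s j hj
      rw [e1, e2] at heq
      simp only at heq
      refine ⟨rep ((r₁, r₂), (i, j), s), Finset.mem_image_of_mem _ ?_, g, ?_⟩
      · simp only [Finset.mem_product, Finset.mem_range]
        exact ⟨⟨hr₁, hr₂⟩, ⟨hB hi, (Finset.mem_sdiff.1 hj).1⟩, hs⟩
      · intro x hx
        by_cases hxB : x ∈ B
        · simp only [rep, hxB, if_true]
          exact hg x hxB
        · simp only [rep, hxB, if_false]
          rw [hg' x (Finset.mem_sdiff.2 ⟨hx, hxB⟩)]
          have : g' = (((stepIn δ B)^[s] r₁) i).2 - (((stepIn δ (A \ B))^[s] r₂) j).2 + g := by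
            rw [sub_add_eq_add_sub, heq]
            abel
          rw [add_assoc, ← this]
  choose! R hR hRep using key
  refine ⟨(A.powerset.filter (fun B => B.Nonempty ∧ (A \ B).Nonempty)).biUnion R, ?_, ?_⟩
  · refine (Finset.card_biUnion_le_card_mul _ _ (N * A.card ^ 2 * T) ?_).trans ?_
    · intro B hB
      rw [Finset.mem_filter, Finset.mem_powerset] at hB
      exact hR B hB.1 hB.2.1 hB.2.2
    · gcongr
      exact (Finset.card_filter_le _ _).trans (Finset.card_powerset A).le
  · intro c hc
    cases hc with
    | single i => simp at hA
    | merge A' B t i j hA' hB hAB hi hj h =>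
      have hsd : (A' ∪ B) \ A' = B := by
        rw [Finset.union_sdiff_left]
        exact Finset.sdiff_eq_self_of_disjoint hAB.symm
      have hne : ((A' ∪ B) \ A').Nonempty := hsd.symm ▸ hB.nonempty
      obtain ⟨r, hr, hrel⟩ := hRep A' Finset.subset_union_left hA'.nonempty hne c hA'
        (hsd.symm ▸ hB) i hi j (hsd.symm ▸ hj) t (by rw [hsd]; exact h)
      refine ⟨r, ?_, hrel⟩
      rw [Finset.mem_biUnion]
      refine ⟨A', ?_, hr⟩
      rw [Finset.mem_filter, Finset.mem_powerset]
      exact ⟨Finset.subset_union_left, hA'.nonempty, hne⟩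

lemma fewVisited_of_fewLinked (hΓ : ∀ g : Γ, g + g = 0) {A : Finset ι} (hA : A.Nonempty) {N T : ℕ}
    (hN : FewLinked δ A N)
    (hT : ∀ B ⊆ A, B.Nonempty → (A \ B).Nonempty →
      ∃ T₁ T₂, FewVisited δ B T₁ ∧ FewVisited δ (A \ B) T₂ ∧ T₁ * T₂ ≤ T) :
    FewVisited δ A (2 * N + T) := by
  obtain ⟨R, hR, h⟩ := hN
  intro c
  by_cases hl : ∀ t ≤ N, Linked δ ((stepIn δ A)^[t] c) A
  · have : Nonempty (∀ i, Q i × Γ) := ⟨c⟩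
    choose! r hr g hg using fun t ht => h _ (hl t ht)
    obtain ⟨a, ha, b, hb, hab, he⟩ := Finset.exists_ne_map_eq_of_card_lt_of_maps_to
      (s := Finset.range (N + 1)) (t := R) (f := r)
      (by rw [Finset.card_range]; omega)
      (fun t ht => hr t (by simp at ht; omega))
    simp only [Finset.mem_range] at ha hb
    wlog hlt : a < b generalizing a b
    · exact this b a hab.symm he.symm hb ha (by omega)
    have hrel : RelOn A (g b - g a) ((stepIn δ A)^[a] c) ((stepIn δ A)^[b] c) := by
      intro i hi
      rw [hg b (by omega) i hi, hg a (by omega) i hi, he]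
      simp only [Prod.mk.injEq, true_and]
      abel
    have hrep : (stepIn δ A)^[a] c = (stepIn δ A)^[b + (b - a)] c := by
      funext i
      by_cases hi : i ∈ A
      · have h1 := hrel.iterate (δ := δ) (b - a) i hi
        rw [← Function.iterate_add_apply, ← Function.iterate_add_apply,
          Nat.sub_add_cancel hlt.le, hrel i hi, add_comm (b - a) b] at h1
        rw [h1]
        simp only [add_assoc, hΓ, add_zero]
      · rw [stepIn_iterate_of_notMem hi, stepIn_iterate_of_notMem hi]
    refine ⟨(Finset.range (b + (b - a))).image (fun t => (stepIn δ A)^[t] c), ?_, ?_⟩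
    · refine Finset.card_image_le.trans ?_
      rw [Finset.card_range]
      omega
    · intro t
      obtain ⟨s, hs, hs'⟩ := exists_lt_iterate_eq_of_iterate_eq (by omega) hrep t
      exact Finset.mem_image.2 ⟨s, by simpa using hs, hs'⟩
  · push Not at hl
    obtain ⟨t₀, ht₀, hl⟩ := hl
    obtain ⟨B, hB, hB1, hB2, hrun⟩ := exists_split_of_not_linked hA hl
    obtain ⟨T₁, T₂, hT₁, hT₂, hTT⟩ := hT B hB hB1 hB2
    obtain ⟨F₁, hF₁, hF₁'⟩ := hT₁ ((stepIn δ A)^[t₀] c)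
    obtain ⟨F₂, hF₂, hF₂'⟩ := hT₂ ((stepIn δ A)^[t₀] c)
    refine ⟨(Finset.range t₀).image (fun t => (stepIn δ A)^[t] c) ∪
      (F₁ ×ˢ F₂).image (fun p => fun i => if i ∈ B then p.1 i else p.2 i), ?_, ?_⟩
    · refine (Finset.card_union_le _ _).trans ?_
      have h1 : ((Finset.range t₀).image (fun t => (stepIn δ A)^[t] c)).card ≤ t₀ :=
        Finset.card_image_le.trans (Finset.card_range _).le
      have h2 : ((F₁ ×ˢ F₂).image
          (fun p => fun i => if i ∈ B then p.1 i else p.2 i)).card ≤ T := by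
        refine Finset.card_image_le.trans ?_
        rw [Finset.card_product]
        exact (Nat.mul_le_mul hF₁ hF₂).trans hTT
      omega
    · intro t
      rw [Finset.mem_union]
      by_cases ht : t < t₀
      · exact Or.inl (Finset.mem_image.2 ⟨t, by simpa using ht, rfl⟩)
      · right
        rw [Finset.mem_image]
        refine ⟨((stepIn δ B)^[t - t₀] ((stepIn δ A)^[t₀] c),
          (stepIn δ (A \ B))^[t - t₀] ((stepIn δ A)^[t₀] c)), ?_, ?_⟩
        · rw [Finset.mem_product]
          exact ⟨hF₁' _, hF₂' _⟩
        · have ht' : (stepIn δ A)^[t] c = (stepIn δ A)^[t - t₀] ((stepIn δ A)^[t₀] c) := by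
            rw [← Function.iterate_add_apply]
            congr 2
            omega
          funext i
          simp only
          by_cases hi : i ∈ B
          · rw [if_pos hi, ht', (hrun (t - t₀)).1 i hi]
          · rw [if_neg hi, ht']
            by_cases hiA : i ∈ A
            · rw [(hrun (t - t₀)).2 i (Finset.mem_sdiff.2 ⟨hiA, hi⟩)]
            · rw [stepIn_iterate_of_notMem hiA,
                stepIn_iterate_of_notMem (fun h => hiA (Finset.mem_sdiff.1 h).1)]

/-- The main counting bound: `p` agents pass through at most `M ^ (8 ^ p + 1)` configurations. -/
lemma fewLinked_and_fewVisited [Fintype ι] [∀ i, Finite (Q i)] (hΓ : ∀ g : Γ, g + g = 0) {M : ℕ}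
    (hM : 3 ≤ M) (hQ : ∀ i, Nat.card (Q i) ≤ M)
    (hι : 2 ^ Fintype.card ι * Fintype.card ι ^ 2 ≤ M) :
    ∀ (p : ℕ) (A : Finset ι), A.card = p → A.Nonempty →
      FewLinked δ A (M ^ 8 ^ p) ∧ FewVisited δ A (M ^ (8 ^ p + 1)) := by
  intro p
  induction p using Nat.strong_induction_on with
  | _ p ih =>
    intro A hAp hA
    have hM1 : 1 ≤ M := by omega
    have hp : 1 ≤ p := hAp ▸ hA.card_pos
    have hparts : ∀ B ⊆ A, B.Nonempty → (A \ B).Nonempty →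
        ∃ a b, 3 + 2 * (8 ^ a + 8 ^ b) ≤ 8 ^ p ∧
          FewLinked δ B (M ^ 8 ^ a) ∧ FewVisited δ B (M ^ (8 ^ a + 1)) ∧
          FewLinked δ (A \ B) (M ^ 8 ^ b) ∧ FewVisited δ (A \ B) (M ^ (8 ^ b + 1)) := by
      intro B hB hB1 hB2
      have hsum := Finset.card_sdiff_add_card_eq_card hB
      have h1 := hB1.card_pos
      have h2 := hB2.card_pos
      obtain ⟨ha1, ha2⟩ := ih B.card (by omega) B rfl hB1
      obtain ⟨hb1, hb2⟩ := ih (A \ B).card (by omega) (A \ B) rfl hB2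
      refine ⟨B.card, (A \ B).card, ?_, ha1, ha2, hb1, hb2⟩
      rw [← hAp, ← hsum, pow_add]
      have h3 : 8 ^ 1 ≤ 8 ^ B.card := Nat.pow_le_pow_right (by norm_num) h1
      have h4 : 8 ^ 1 ≤ 8 ^ (A \ B).card := Nat.pow_le_pow_right (by norm_num) h2
      nlinarith
    have hlin : FewLinked δ A (M ^ 8 ^ p) := by
      by_cases hp1 : p = 1
      · subst hp1
        obtain ⟨i, rfl⟩ := Finset.card_eq_one.1 hAp
        exact (fewLinked_singleton i (hQ i)).mono (Nat.le_self_pow (by norm_num) M)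
      · let E := (8 ^ p - 3) / 2
        refine (fewLinked_of_parts (by omega) (N := M ^ E) (T := M ^ (E + 2)) ?_).mono ?_
        · intro B hB hB1 hB2
          obtain ⟨a, b, hab, h1, h2, h3, h4⟩ := hparts B hB hB1 hB2
          refine ⟨_, _, _, _, h1, h3, h2, h4, ?_, ?_⟩
          · rw [← pow_add]
            exact Nat.pow_le_pow_right hM1 (by omega)
          · rw [← pow_add]
            exact Nat.pow_le_pow_right hM1 (by omega)
        · have hcard : A.card ≤ Fintype.card ι := Finset.card_le_univ A
          have h8 : 8 ^ 2 ≤ 8 ^ p := Nat.pow_le_pow_right (by norm_num) (by omega)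
          calc 2 ^ A.card * (M ^ E * A.card ^ 2 * M ^ (E + 2))
              = 2 ^ A.card * A.card ^ 2 * (M ^ E * M ^ (E + 2)) := by ring
            _ ≤ 2 ^ Fintype.card ι * Fintype.card ι ^ 2 * (M ^ E * M ^ (E + 2)) := by
                gcongr
                norm_num
            _ ≤ M * (M ^ E * M ^ (E + 2)) := by gcongr
            _ = M ^ (2 * E + 3) := by ring
            _ ≤ M ^ 8 ^ p := Nat.pow_le_pow_right hM1 (by omega)
    refine ⟨hlin, ?_⟩
    refine (fewVisited_of_fewLinked hΓ hA hlin (T := M ^ 8 ^ p) ?_).mono ?_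
    · intro B hB hB1 hB2
      obtain ⟨a, b, hab, h1, h2, h3, h4⟩ := hparts B hB hB1 hB2
      refine ⟨_, _, h2, h4, ?_⟩
      rw [← pow_add]
      exact Nat.pow_le_pow_right hM1 (by omega)
    · rw [pow_succ]
      nlinarith [Nat.zero_le (M ^ 8 ^ p)]

end Counting

/-! ### Hypercubes -/

/-- The port-labeled hypercube of dimension `d`, transported along `e` to the vertex set `V`:
port `i` flips coordinate `i`. -/
def cubeGraph {V : Type} {d : ℕ} (e : V ≃ (Fin d → ZMod 2)) : PGraph V where
  deg := fun _ => d
  nbr := fun v i => if h : i < d then e.symm (e v + Pi.single ⟨i, h⟩ 1) else v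
  back := fun _ i => i

lemma cubeGroup_add_self {d : ℕ} (g : Fin d → ZMod 2) : g + g = 0 := by
  funext i
  exact CharTwo.add_self_eq_zero (g i)

lemma cubeGraph_wf {V : Type} {d : ℕ} (hd : 0 < d) (e : V ≃ (Fin d → ZMod 2)) :
    (cubeGraph e).Wf := by
  refine ⟨fun _ => hd, fun _ _ h => h, ?_, fun _ _ _ => rfl, ?_, ?_⟩
  · intro v i hi
    have hi : i < d := hi
    simp only [cubeGraph, hi, dif_pos, Equiv.apply_symm_apply, add_assoc, cubeGroup_add_self,
      add_zero, Equiv.symm_apply_apply]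
  · intro v i hi h
    have hi : i < d := hi
    simp only [cubeGraph, hi, dif_pos, Equiv.symm_apply_eq, add_eq_left,
      Pi.single_eq_zero_iff] at h
    exact one_ne_zero h
  · intro v i hi j hj h
    have hi : i < d := hi
    have hj : j < d := hj
    simp only [cubeGraph, hi, hj, dif_pos, EmbeddingLike.apply_eq_iff_eq, add_right_inj] at h
    have h2 := congrFun h ⟨i, hi⟩
    by_contra hij
    rw [Pi.single_eq_same, Pi.single_eq_of_ne (by simpa using hij)] at h2
    exact one_ne_zero h2

lemma cubeGraph_conn {V : Type} {d : ℕ} (e : V ≃ (Fin d → ZMod 2)) : (cubeGraph e).Conn := by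
  intro a b
  have key : ∀ S : Finset (Fin d), Relation.ReflTransGen
      (fun x y => ∃ i, i < (cubeGraph e).deg x ∧ (cubeGraph e).nbr x i = y) a
      (e.symm (e a + ∑ i ∈ S, Pi.single i ((e b - e a) i))) := by
    intro S
    induction S using Finset.induction_on with
    | empty => simpa using Relation.ReflTransGen.refl
    | insert i S hi ih =>
      rw [Finset.sum_insert hi]
      have h01 : ∀ x : ZMod 2, x = 0 ∨ x = 1 := by decide
      rcases h01 ((e b - e a) i) with h0 | h1
      · rw [h0, Pi.single_zero, zero_add]
        exact ih
      · refine ih.tail ⟨i, i.2, ?_⟩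
        simp only [cubeGraph, i.2, dif_pos, Equiv.apply_symm_apply, h1, Fin.eta]
        congr 1
        abel
  have h := key Finset.univ
  rw [Finset.univ_sum_single] at h
  simpa using h

/-- The transition functions of the system on a hypercube of dimension `d`. -/
def cubeTrans {k : ℕ} {sz : Fin k → ℕ} (Sys : MAgentSys k sz) (d : ℕ) (i : Fin k)
    (q : Fin (sz i) × Fin d) (vis : ∀ j, Option (Fin (sz j) × Fin d)) :
    (Fin (sz i) × Fin d) × (Fin d → ZMod 2) :=
  if q.1 ∈ Sys.halt i then (q, 0)
  else
    let out := Sys.trans i q.1 (fun j => if j = i then none else (vis j).map Prod.fst) d q.2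
    match out.2 with
    | none => ((out.1, q.2), 0)
    | some l => if h : l < d then ((out.1, ⟨l, h⟩), Pi.single ⟨l, h⟩ 1) else ((out.1, q.2), 0)

/-- The configuration of the system that corresponds to a configuration on the group. -/
def cubeConfig {V : Type} {k : ℕ} {sz : Fin k → ℕ} {d : ℕ} (e : V ≃ (Fin d → ZMod 2))
    (c : ∀ i : Fin k, (Fin (sz i) × Fin d) × (Fin d → ZMod 2)) : MConfig V k sz where
  st := fun i => (c i).1.1
  pos := fun i => e.symm (c i).2
  lab := fun i => (c i).1.2

lemma mStep_cubeConfig {V : Type} {k : ℕ} {sz : Fin k → ℕ} {d : ℕ} (e : V ≃ (Fin d → ZMod 2))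
    (Sys : MAgentSys k sz) (c : ∀ i : Fin k, (Fin (sz i) × Fin d) × (Fin d → ZMod 2)) :
    mStep Sys (cubeGraph e) (cubeConfig e c) =
      cubeConfig e (stepIn (cubeTrans Sys d) Finset.univ c) := by
  have hvis : ∀ i, mVis (cubeConfig e c) i =
      fun j => if j = i then none else (visIn Finset.univ c i j).map Prod.fst := by
    intro i
    funext j
    by_cases hj : j = i
    · simp [mVis, hj]
    · by_cases hp : (c j).2 = (c i).2 <;> simp [mVis, visIn, cubeConfig, hj, hp]
  have hout : ∀ i, mOut Sys (cubeGraph e) (cubeConfig e c) i =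
      Sys.trans i (c i).1.1
        (fun j => if j = i then none else (visIn Finset.univ c i j).map Prod.fst) d (c i).1.2 := by
    intro i
    rw [mOut, hvis]
    rfl
  have hst : ∀ i, (cubeConfig e c).st i = (c i).1.1 := fun _ => rfl
  have hpos : ∀ i, (cubeConfig e c).pos i = e.symm (c i).2 := fun _ => rfl
  have hlab : ∀ i, (cubeConfig e c).lab i = (c i).1.2 := fun _ => rfl
  have hagent : ∀ i,
      (mStep Sys (cubeGraph e) (cubeConfig e c)).st i =
        (cubeConfig e (stepIn (cubeTrans Sys d) Finset.univ c)).st i ∧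
      (mStep Sys (cubeGraph e) (cubeConfig e c)).pos i =
        (cubeConfig e (stepIn (cubeTrans Sys d) Finset.univ c)).pos i ∧
      (mStep Sys (cubeGraph e) (cubeConfig e c)).lab i =
        (cubeConfig e (stepIn (cubeTrans Sys d) Finset.univ c)).lab i := by
    intro i
    simp only [mStep, hout, hst, hpos, hlab]
    simp only [cubeConfig, stepIn, Finset.mem_univ, if_true, cubeTrans]
    by_cases hh : (c i).1.1 ∈ Sys.halt i
    · simp [hh]
    · simp only [hh, if_false]
      generalize Sys.trans i (c i).1.1
        (fun j => if j = i then none else (visIn Finset.univ c i j).map Prod.fst) d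
          (c i).1.2 = out
      obtain ⟨q, _ | l⟩ := out
      · simp
      · by_cases hl : l < d <;> simp [cubeGraph, hl]
  rw [MConfig.mk.injEq (mStep Sys (cubeGraph e) (cubeConfig e c)).st]
  exact ⟨funext fun i => (hagent i).1, funext fun i => (hagent i).2.1,
    funext fun i => (hagent i).2.2⟩

/-- Agents that explore the hypercube of dimension `d` satisfy a lower bound on their number
and memory. -/
lemma two_pow_le_of_explores {k : ℕ} {sz : Fin k → ℕ} (Sys : MAgentSys k sz) {d M : ℕ}
    (hd : 0 < d) (hM : 3 ≤ M) (hsz : ∀ i, sz i * d ≤ M) (hk : 2 ^ k * k ^ 2 ≤ M)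
    (hexp : ∀ G : PGraph (Fin (2 ^ d)), G.Wf → G.Conn →
      ∀ v0 w : Fin (2 ^ d), ∃ (t : ℕ) (i : Fin k), (mRun Sys G v0 t).pos i = w) :
    2 ^ d ≤ M ^ (8 ^ k + 2) := by
  let e : Fin (2 ^ d) ≃ (Fin d → ZMod 2) := Fintype.equivOfCardEq (by simp)
  have hvisit := hexp (cubeGraph e) (cubeGraph_wf hd e) (cubeGraph_conn e) (e.symm 0)
  have hk0 : 0 < k := by
    obtain ⟨_, i, _⟩ := hvisit (e.symm 0)
    exact i.pos
  let c₀ : ∀ i : Fin k, (Fin (sz i) × Fin d) × (Fin d → ZMod 2) :=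
    fun i => ((Sys.start i, ⟨0, hd⟩), 0)
  have hrun : ∀ t, mRun Sys (cubeGraph e) (e.symm 0) t =
      cubeConfig e ((stepIn (cubeTrans Sys d) Finset.univ)^[t] c₀) := by
    intro t
    induction t with
    | zero => rfl
    | succ t ih =>
      rw [Function.iterate_succ_apply', ← mStep_cubeConfig, ← ih, mRun, mRun,
        Function.iterate_succ_apply']
  obtain ⟨F, hF, hF'⟩ := (fewLinked_and_fewVisited (δ := cubeTrans Sys d) cubeGroup_add_self hM
    (fun i => by simpa using hsz i) (by simpa using hk) k Finset.univ (by simp)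
    ⟨⟨0, hk0⟩, Finset.mem_univ _⟩).2 c₀
  have hcover : (Finset.univ : Finset (Fin (2 ^ d))) ⊆
      (F ×ˢ (Finset.univ : Finset (Fin k))).image (fun p => e.symm (p.1 p.2).2) := by
    intro w _
    obtain ⟨t, i, h⟩ := hvisit w
    rw [hrun] at h
    exact Finset.mem_image.2 ⟨(_, i), by simpa using hF' t, h⟩
  have hkM : k ≤ M := by
    refine le_trans ?_ hk
    have : 1 ≤ 2 ^ k := Nat.one_le_two_pow
    nlinarith
  calc 2 ^ d = (Finset.univ : Finset (Fin (2 ^ d))).card := by simp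
    _ ≤ (F ×ˢ (Finset.univ : Finset (Fin k))).card :=
      (Finset.card_le_card hcover).trans Finset.card_image_le
    _ = F.card * k := by simp
    _ ≤ M ^ (8 ^ k + 1) * M := Nat.mul_le_mul hF hkM
    _ = M ^ (8 ^ k + 2) := by ring

/-! ### Asymptotics -/

lemma eventually_exponent_lt {ε : ℝ} (hε : 0 < ε) (hε1 : ε < 1) (c a : ℝ) (ha : 0 ≤ a) :
    ∀ᶠ L : ℝ in Filter.atTop,
      (c * L ^ (1 - ε) + Real.logb 2 L + 3 * (a * Real.log L) + 3) * (3 * L ^ (ε / 2)) < L - 1 := by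
  have hlog : ∀ᶠ L : ℝ in Filter.atTop, ‖Real.log L‖ ≤ 1 * ‖L ^ (1 - ε)‖ :=
    (isLittleO_log_rpow_atTop (by linarith : (0 : ℝ) < 1 - ε)).bound one_pos
  set K : ℝ := (c + 1 / Real.log 2 + 3 * a + 3) * 3 with hK
  have hK' : ∀ᶠ L : ℝ in Filter.atTop, K + 1 < L ^ (ε / 2) :=
    (tendsto_rpow_atTop (by linarith : (0 : ℝ) < ε / 2)).eventually_gt_atTop _
  filter_upwards [hlog, hK', Filter.eventually_gt_atTop 1] with L h1 h2 h3
  have hL0 : 0 < L := by linarith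
  have hp : 1 ≤ L ^ (1 - ε) := Real.one_le_rpow h3.le (by linarith)
  have hq : 0 < L ^ (ε / 2) := Real.rpow_pos_of_pos hL0 _
  have hl2 : 0 < Real.log 2 := Real.log_pos (by norm_num)
  have hlog0 : 0 ≤ Real.log L := Real.log_nonneg h3.le
  rw [Real.norm_of_nonneg hlog0, Real.norm_of_nonneg (by linarith), one_mul] at h1
  set X := L ^ (1 - ε) with hX
  set Y := L ^ (ε / 2) with hY
  have hXY : X * Y * Y = L := by
    rw [hX, hY, ← Real.rpow_add hL0, ← Real.rpow_add hL0,
      show 1 - ε + ε / 2 + ε / 2 = 1 by ring, Real.rpow_one]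
  have hY1 : 1 ≤ Y := Real.one_le_rpow h3.le (by linarith)
  have hb : Real.logb 2 L ≤ 1 / Real.log 2 * X := by
    rw [Real.logb, div_eq_mul_one_div, mul_comm]
    exact mul_le_mul_of_nonneg_left h1 (by positivity)
  have ha' : a * Real.log L ≤ a * X := mul_le_mul_of_nonneg_left h1 ha
  have hsum : (c * X + Real.logb 2 L + 3 * (a * Real.log L) + 3) * (3 * Y) ≤ K * (X * Y) := by
    have : c * X + Real.logb 2 L + 3 * (a * Real.log L) + 3 ≤
        (c + 1 / Real.log 2 + 3 * a + 3) * X := by linarith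
    calc _ ≤ ((c + 1 / Real.log 2 + 3 * a + 3) * X) * (3 * Y) := by gcongr
      _ = K * (X * Y) := by rw [hK]; ring
  have hXY1 : 1 ≤ X * Y := one_le_mul_of_one_le_of_one_le hp hY1
  have : (K + 1) * (X * Y) < L := by
    rw [← hXY, mul_comm]
    exact mul_lt_mul_of_pos_left h2 (by linarith)
  linarith

/-- For every `0 < ε < 1` and every constant `c` there is a
constant `c' > 0` such that for all sufficiently large `n`: if a set of `k`
collaborating agents with at most `2^(c·(log n)^(1-ε))` states each explores
every connected graph on at most `n` vertices (from every starting vertex),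
then `k ≥ c'·log log n`. -/
theorem lower_bound_agents :
    ∀ ε : ℝ, 0 < ε → ε < 1 → ∀ c : ℕ, 0 < c →
      ∃ c' : ℝ, 0 < c' ∧ ∃ N : ℕ, ∀ n : ℕ, N ≤ n →
        ∀ (k : ℕ) (sz : Fin k → ℕ) (Sys : MAgentSys k sz),
          (∀ i, (sz i : ℝ) ≤ (2 : ℝ) ^ ((c : ℝ) * Real.logb 2 (n : ℝ) ^ ((1 : ℝ) - ε))) →
          (∀ m : ℕ, 0 < m → m ≤ n → ∀ G : PGraph (Fin m), G.Wf → G.Conn →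
            ∀ v0 w : Fin m, ∃ (t : ℕ) (i : Fin k), (mRun Sys G v0 t).pos i = w) →
          c' * Real.log (Real.log (n : ℝ)) ≤ (k : ℝ) := by
  intro ε hε hε1 c _
  have h8 : 0 < Real.log 8 := Real.log_pos (by norm_num)
  have hl2 : 0 < Real.log 2 := Real.log_pos (by norm_num)
  set a : ℝ := ε / (2 * Real.log 8) with ha
  have ha0 : 0 < a := by positivity
  refine ⟨a, ha0, ?_⟩
  have hlogn : Filter.Tendsto (fun n : ℕ => Real.log (n : ℝ)) Filter.atTop Filter.atTop :=
    Real.tendsto_log_atTop.comp tendsto_natCast_atTop_atTop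
  have hL : Filter.Tendsto (fun n : ℕ => Real.logb 2 (n : ℝ)) Filter.atTop Filter.atTop :=
    hlogn.atTop_div_const hl2
  obtain ⟨N, hN⟩ := Filter.eventually_atTop.1
    ((hL.eventually (eventually_exponent_lt hε hε1 c a ha0.le)).and
      ((hlogn.eventually_ge_atTop 1).and (Filter.eventually_ge_atTop 2)))
  refine ⟨N, fun n hn k sz Sys hsz hexp => ?_⟩
  obtain ⟨hlt, hn1, hn2⟩ := hN n hn
  by_contra! hk
  set L := Real.logb 2 (n : ℝ) with hLdef
  have hn0 : (0 : ℝ) < n := by positivity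
  have hlogL : Real.log n ≤ L := by
    have : Real.log 2 ≤ 1 := (Real.log_two_lt_d9.le).trans (by norm_num)
    rw [hLdef, Real.logb, le_div_iff₀ hl2]
    nlinarith
  have hL1 : 1 ≤ L := hn1.trans hlogL
  set d := Nat.log 2 n with hd
  have hd0 : 0 < d := Nat.log_pos (by norm_num) hn2
  have hdn : 2 ^ d ≤ n := Nat.pow_log_le_self 2 (by omega)
  have hdL : (d : ℝ) ≤ L := by
    rw [hLdef, Real.le_logb_iff_rpow_le (by norm_num) hn0, Real.rpow_natCast]
    exact_mod_cast hdn
  have hLd : L < d + 1 := by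
    rw [hLdef, Real.logb_lt_iff_lt_rpow (by norm_num) hn0]
    have : n < 2 ^ (d + 1) := Nat.lt_pow_succ_log_self (by norm_num) n
    exact_mod_cast this
  have hkL : (k : ℝ) ≤ a * Real.log L :=
    hk.le.trans (mul_le_mul_of_nonneg_left (Real.log_le_log (by linarith) hlogL) ha0.le)
  have h8k : (8 : ℝ) ^ k ≤ L ^ (ε / 2) := by
    have hexp8 : (k : ℝ) * Real.log 8 ≤ ε / 2 * Real.log L := by
      calc (k : ℝ) * Real.log 8 ≤ a * Real.log L * Real.log 8 := by gcongr
        _ = ε / 2 * Real.log L := by rw [ha]; field_simp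
    rw [← Real.log_le_log_iff (by positivity) (Real.rpow_pos_of_pos (by linarith) _),
      Real.log_pow, Real.log_rpow (by linarith)]
    exact hexp8
  set x : ℝ := c * L ^ (1 - ε) + Real.logb 2 L with hx
  have hx0 : 0 ≤ x := add_nonneg (mul_nonneg (Nat.cast_nonneg c) (Real.rpow_nonneg (by linarith) _))
    (Real.logb_nonneg (by norm_num) hL1)
  set m : ℕ := ⌈x⌉₊ + 3 * k + 2 with hm
  have hmx : (m : ℝ) < x + 3 * (a * Real.log L) + 3 := by
    have := Nat.ceil_lt_add_one hx0
    rw [hm]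
    push_cast
    linarith
  have hpow := two_pow_le_of_explores Sys (M := 2 ^ m) hd0
    ((by norm_num : 3 ≤ 2 ^ 2).trans (Nat.pow_le_pow_right (by norm_num) (by omega)))
    (by
      intro i
      have h1 : (sz i : ℝ) * d ≤ (2 : ℝ) ^ x := by
        rw [hx, Real.rpow_add (by norm_num), Real.rpow_logb (by norm_num) (by norm_num)
          (by linarith)]
        exact mul_le_mul (hsz i) hdL (by positivity) (by positivity)
      have h2 : (2 : ℝ) ^ x ≤ (2 : ℝ) ^ (m : ℝ) := by
        refine Real.rpow_le_rpow_of_exponent_le (by norm_num) ((Nat.le_ceil x).trans ?_)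
        rw [hm]
        exact_mod_cast (by omega : ⌈x⌉₊ ≤ ⌈x⌉₊ + 3 * k + 2)
      rw [Real.rpow_natCast] at h2
      exact_mod_cast h1.trans h2)
    (by
      calc 2 ^ k * k ^ 2 ≤ 2 ^ k * (2 ^ k) ^ 2 := by
            gcongr
            exact Nat.lt_two_pow_self.le
        _ = 2 ^ (3 * k) := by ring
        _ ≤ 2 ^ m := Nat.pow_le_pow_right (by norm_num) (by omega))
    (hexp (2 ^ d) (by positivity) hdn)
  rw [← pow_mul, Nat.pow_le_pow_iff_right (by norm_num)] at hpow
  have hpow' : (d : ℝ) ≤ m * (8 ^ k + 2) := by exact_mod_cast hpow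
  have hY : 1 ≤ L ^ (ε / 2) := Real.one_le_rpow hL1 (by linarith)
  have hbound : (m : ℝ) * (8 ^ k + 2) ≤
      (x + 3 * (a * Real.log L) + 3) * (3 * L ^ (ε / 2)) :=
    mul_le_mul hmx.le (by linarith) (by positivity) (by linarith [Nat.cast_nonneg (α := ℝ) m])
  linarith
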